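/- Let v be a bounded solution of the ODE (O6) that is eventually strictly monotone at +∞, i.e. there exists T such that either v'(t) > 0 for all t ≥ T or v'(t) < 0 for all t ≥ T. Then v(t) converges as t → +∞ to a limit ℓ belonging to {0, a*_n, -a*_n}, and v⁽ʲ⁾(t) → 0 as t → +∞ for every j = 1, 2, 3, 4, 5. -/

import Mathlib

noncomputable section

open Real

def cN (n : ℕ) : ℝ := (n : ℝ) * ((n : ℝ) - 6) * ((n : ℝ) ^ 4 - 20 * (n : ℝ) ^ 2 + 64) / 64
def K0 (n : ℕ) : ℝ := ((n : ℝ) - 6) ^ 2 * ((n : ℝ) - 2) ^ 2 * ((n : ℝ) + 2) ^ 2 / 64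
def K2 (n : ℕ) : ℝ := (3 * (n : ℝ) ^ 4 - 24 * (n : ℝ) ^ 3 + 72 * (n : ℝ) ^ 2 - 96 * (n : ℝ) + 304) / 16
def K4 (n : ℕ) : ℝ := (3 * (n : ℝ) ^ 2 - 12 * (n : ℝ) + 44) / 4

/-- `v` is a (classical, entire) solution of the sixth order ODE (O6). -/
def IsSolO6 (n : ℕ) (v : ℝ → ℝ) : Prop :=
  ContDiff ℝ 6 v ∧ ∀ t : ℝ,
    iteratedDeriv 6 v t - K4 n * iteratedDeriv 4 v t + K2 n * iteratedDeriv 2 v t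
      - K0 n * v t + cN n * |v t| ^ (12 / ((n : ℝ) - 6)) * v t = 0

def aStar (n : ℕ) : ℝ := (K0 n / cN n) ^ (((n : ℝ) - 6) / 12)

open Filter

/-- Landau-type interpolation: on a unit interval, a first derivative is controlled by the function
and a small multiple of the second derivative. -/
theorem abs_deriv_le_of_abs_le_Icc {f f' f'' : ℝ → ℝ} (hf : ∀ s, HasDerivAt f (f' s) s)
    (hf' : ∀ s, HasDerivAt f' (f'' s) s) {t ε P R : ℝ} (hε : 0 < ε) (hε1 : ε ≤ 1)
    (hP : ∀ s ∈ Set.Icc t (t + 1), |f s| ≤ P) (hR : ∀ s ∈ Set.Icc t (t + 1), |f'' s| ≤ R)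
    {s : ℝ} (hs : s ∈ Set.Icc t (t + 1)) : |f' s| ≤ 2 / ε * P + ε * R := by
  obtain ⟨hs1, hs2⟩ := hs
  obtain ⟨a, hta, hat, has, hsa⟩ : ∃ a, t ≤ a ∧ a + ε ≤ t + 1 ∧ a ≤ s ∧ s ≤ a + ε := by
    rcases le_total s (t + 1 - ε) with h | h
    · exact ⟨s, hs1, by linarith, le_rfl, by linarith⟩
    · exact ⟨t + 1 - ε, by linarith, by linarith, h, by linarith⟩
  obtain ⟨ξ, ⟨hξ1, hξ2⟩, hξ⟩ := exists_hasDerivAt_eq_slope f f' (show a < a + ε by linarith)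
    (fun x _ => (hf x).continuousAt.continuousWithinAt) (fun x _ => hf x)
  have hfξ : |f' ξ| ≤ 2 / ε * P := by
    have h1 := hP a ⟨hta, by linarith⟩
    have h2 := hP (a + ε) ⟨by linarith, hat⟩
    rw [hξ, add_sub_cancel_left, abs_div, abs_of_pos hε, div_mul_eq_mul_div]
    gcongr
    linarith [abs_sub (f (a + ε)) (f a)]
  have hR0 : 0 ≤ R := (abs_nonneg _).trans (hR s ⟨hs1, hs2⟩)
  have hlip : |f' s - f' ξ| ≤ R * |s - ξ| :=
    (convex_Icc t (t + 1)).norm_image_sub_le_of_norm_hasDerivWithin_le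
      (fun x _ => (hf' x).hasDerivWithinAt) hR ⟨by linarith, by linarith⟩ ⟨hs1, hs2⟩
  have hdist : |s - ξ| ≤ ε := abs_le.2 ⟨by linarith, by linarith⟩
  have h3 : R * |s - ξ| ≤ ε * R := by nlinarith
  linarith [abs_sub_abs_le_abs_sub (f' s) (f' ξ)]

/-- Iterating the interpolation inequality between consecutive seminorms. -/
theorem exists_interpolation_const {A : ℕ → ℝ → ℝ} {m : ℕ} (hA0 : ∀ k t, 0 ≤ A k t)
    (hA : ∀ k < m, ∀ ε, 0 < ε → ε ≤ 1 → ∀ t,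
      A (k + 1) t ≤ 2 / ε * A k t + ε * A (k + 2) t) :
    ∀ k ≤ m, ∀ η > 0, ∃ C, 0 ≤ C ∧ ∀ t, A k t ≤ C * A 0 t + η * A (k + 1) t := by
  intro k
  induction k with
  | zero =>
    intro _ η hη
    exact ⟨1, zero_le_one, fun t => by nlinarith [hA0 1 t]⟩
  | succ k ih =>
    intro hk η hη
    obtain ⟨ε, hε, hε1, hεη⟩ : ∃ ε : ℝ, 0 < ε ∧ ε ≤ 1 ∧ 2 * ε ≤ η :=
      ⟨min 1 (η / 2), by positivity, min_le_left _ _, by linarith [min_le_right 1 (η / 2)]⟩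
    obtain ⟨C, hC, h⟩ := ih (by omega) (ε / 4) (by positivity)
    refine ⟨4 * C / ε, by positivity, fun t => ?_⟩
    have h1 := hA k (by omega) ε hε hε1 t
    have h2 : 2 / ε * A k t ≤ 2 / ε * (C * A 0 t + ε / 4 * A (k + 1) t) := by
      gcongr
      exact h t
    have h3 : 2 / ε * (C * A 0 t + ε / 4 * A (k + 1) t)
        = 4 * C / ε * A 0 t / 2 + A (k + 1) t / 2 := by
      field_simp
      ring
    have h4 : 2 * ε * A (k + 2) t ≤ η * A (k + 2) t :=
      mul_le_mul_of_nonneg_right hεη (hA0 _ _)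
    change A (k + 1) t ≤ 4 * C / ε * A 0 t + η * A (k + 2) t
    linarith

/-- If a function tends to zero and its sixth derivative is bounded by its fourth and second
derivatives up to a bounded term, then its derivatives up to order five tend to zero. -/
theorem tendsto_zero_derivs_of_sixth_order_bound {f : ℕ → ℝ → ℝ}
    (hd : ∀ k < 6, ∀ t, HasDerivAt (f k) (f (k + 1) t) t) (hc : ∀ k, Continuous (f k))
    {a b B P : ℝ} (ha : 0 ≤ a) (hb : 0 ≤ b)
    (h6 : ∀ t, |f 6 t| ≤ a * |f 4 t| + b * |f 2 t| + B) (hP : ∀ t, |f 0 t| ≤ P)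
    (hlim : Tendsto (f 0) atTop (nhds 0)) :
    ∀ k ≤ 5, Tendsto (f k) atTop (nhds 0) := by
  let A : ℕ → ℝ → ℝ := fun k t => sSup ((fun s => |f k s|) '' Set.Icc t (t + 1))
  have hle : ∀ k t, ∀ s ∈ Set.Icc t (t + 1), |f k s| ≤ A k t := fun k t s hs =>
    le_csSup (isCompact_Icc.image (hc k).abs).bddAbove ⟨s, hs, rfl⟩
  have hmem : ∀ t : ℝ, t ∈ Set.Icc t (t + 1) := fun t => ⟨le_rfl, by linarith⟩
  have hsup : ∀ k t c, (∀ s ∈ Set.Icc t (t + 1), |f k s| ≤ c) → A k t ≤ c := by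
    intro k t c h
    apply csSup_le (Set.Nonempty.image _ ⟨t, hmem t⟩)
    rintro _ ⟨s, hs, rfl⟩
    exact h s hs
  have hA0 : ∀ k t, 0 ≤ A k t := fun k t => (abs_nonneg _).trans (hle k t t (hmem t))
  have key := exists_interpolation_const (m := 5) hA0 (by
    intro k hk ε hε hε1 t
    exact hsup _ _ _ fun s hs => abs_deriv_le_of_abs_le_Icc (hd k (by omega))
      (hd (k + 1) (by omega)) hε hε1 (hle k t) (hle (k + 2) t) hs)
  have hAP : ∀ t, A 0 t ≤ P := fun t => hsup _ _ _ fun s _ => hP s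
  have hA6 : ∀ t, A 6 t ≤ a * A 4 t + b * A 2 t + B := fun t => hsup _ _ _ fun s hs => by
    have h4 := mul_le_mul_of_nonneg_left (hle 4 t s hs) ha
    have h2 := mul_le_mul_of_nonneg_left (hle 2 t s hs) hb
    linarith [h6 s]
  obtain ⟨M, hM⟩ : ∃ M, ∀ t, A 6 t ≤ M := by
    obtain ⟨C5, hC5, h5⟩ := key 5 le_rfl (1 / (2 * (a + b + 1))) (by positivity)
    obtain ⟨C4, hC4, h4⟩ := key 4 (by norm_num) 1 one_pos
    obtain ⟨C3, hC3, h3⟩ := key 3 (by norm_num) 1 one_pos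
    obtain ⟨C2, hC2, h2⟩ := key 2 (by norm_num) 1 one_pos
    refine ⟨2 * ((a + b) * ((C2 + C3 + C4 + C5) * P) + B), fun t => ?_⟩
    have g0 := hA0 0 t
    have e2 := mul_le_mul_of_nonneg_left (hAP t) hC2
    have e3 := mul_le_mul_of_nonneg_left (hAP t) hC3
    have e4 := mul_le_mul_of_nonneg_left (hAP t) hC4
    have e5 := mul_le_mul_of_nonneg_left (hAP t) hC5
    have p2 := mul_nonneg hC2 g0
    have p3 := mul_nonneg hC3 g0
    set S := (C2 + C3 + C4 + C5) * P + 1 / (2 * (a + b + 1)) * A 6 t with hS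
    have k2 := h2 t
    have k3 := h3 t
    have k4 := h4 t
    have k5 := h5 t
    norm_num only at k2 k3 k4 k5 hS
    have s4 : A 4 t ≤ S := by simp only [one_div] at *; linarith
    have s2 : A 2 t ≤ S := by simp only [one_div] at *; linarith
    have m4 := mul_le_mul_of_nonneg_left s4 ha
    have m2 := mul_le_mul_of_nonneg_left s2 hb
    have q : (a + b) * (1 / (2 * (a + b + 1)) * A 6 t) ≤ A 6 t / 2 := by
      have : (a + b) * (1 / (2 * (a + b + 1))) ≤ 1 / 2 := by
        rw [mul_one_div, div_le_div_iff₀ (by positivity) two_pos]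
        linarith
      nlinarith [hA0 6 t]
    have e : (a + b) * S = (a + b) * ((C2 + C3 + C4 + C5) * P)
        + (a + b) * (1 / (2 * (a + b + 1)) * A 6 t) := by
      rw [hS]; ring
    linarith [hA6 t]
  have hlim0 : Tendsto (A 0) atTop (nhds 0) := by
    rw [Metric.tendsto_atTop] at hlim ⊢
    intro ε hε
    obtain ⟨T, hT⟩ := hlim (ε / 2) (by positivity)
    refine ⟨T, fun t ht => ?_⟩
    have : A 0 t ≤ ε / 2 := hsup _ _ _ fun s hs => by
      have := hT s (ht.trans hs.1)
      rw [Real.dist_eq, sub_zero] at this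
      exact this.le
    rw [Real.dist_eq, sub_zero, abs_of_nonneg (hA0 0 t)]
    linarith
  have step : ∀ k ≤ 5, (∃ M, ∀ t, A (k + 1) t ≤ M) → Tendsto (A k) atTop (nhds 0) := by
    rintro k hk ⟨M, hM⟩
    have hM0 : 0 ≤ M := (hA0 _ 0).trans (hM 0)
    rw [Metric.tendsto_atTop]
    intro ε hε
    obtain ⟨C, hC, h⟩ := key k hk (ε / (2 * (M + 1))) (by positivity)
    have hT : ∀ᶠ t in atTop, C * A 0 t < ε / 2 := by
      have := hlim0.const_mul C
      rw [mul_zero] at this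
      exact this.eventually_lt_const (by positivity)
    obtain ⟨T, hT⟩ := eventually_atTop.1 hT
    refine ⟨T, fun t ht => ?_⟩
    rw [Real.dist_eq, sub_zero, abs_of_nonneg (hA0 k t)]
    have h1 : ε / (2 * (M + 1)) * A (k + 1) t ≤ ε / 2 := by
      calc ε / (2 * (M + 1)) * A (k + 1) t ≤ ε / (2 * (M + 1)) * (M + 1) := by
            gcongr
            linarith [hM t]
        _ = ε / 2 := by field_simp
    linarith [h t, hT t ht]
  have bdd : ∀ k ≤ 6, ∃ M, ∀ t, A k t ≤ M := by
    intro k hk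
    induction hk using Nat.decreasingInduction with
    | self => exact ⟨M, hM⟩
    | of_succ k hk ih =>
      obtain ⟨M', hM'⟩ := ih
      obtain ⟨C, hC, h⟩ := key k (by omega) 1 one_pos
      refine ⟨C * P + M', fun t => ?_⟩
      linarith [h t, hM' t, mul_le_mul_of_nonneg_left (hAP t) hC]
  intro k hk
  refine squeeze_zero_norm (fun t => ?_) (step k hk (bdd (k + 1) (by omega)))
  exact hle k t t (hmem t)

/-- If a function converges and its derivative converges, the limit of the derivative is zero. -/
theorem eq_zero_of_tendsto_of_tendsto_deriv {f f' : ℝ → ℝ} (hf : ∀ t, HasDerivAt f (f' t) t)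
    {c L : ℝ} (h : Tendsto f atTop (nhds c)) (h' : Tendsto f' atTop (nhds L)) : L = 0 := by
  have hex : ∀ t, ∃ ξ, t ≤ ξ ∧ f' ξ = f (t + 1) - f t := fun t => by
    obtain ⟨ξ, hξ, e⟩ := exists_hasDerivAt_eq_slope f f' (show t < t + 1 by linarith)
      (fun x _ => (hf x).continuousAt.continuousWithinAt) (fun x _ => hf x)
    exact ⟨ξ, hξ.1.le, by rw [e]; simp⟩
  choose ξ hξ e using hex
  have h1 : Tendsto (fun t => f' (ξ t)) atTop (nhds L) :=
    h'.comp (tendsto_atTop_mono hξ tendsto_id)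
  have h2 : Tendsto (fun t => f (t + 1) - f t) atTop (nhds (c - c)) :=
    (h.comp (tendsto_atTop_add_const_right _ 1 tendsto_id)).sub h
  simp only [e] at h1
  rw [tendsto_nhds_unique h1 h2, sub_self]

/-- A bounded function that is eventually increasing converges at infinity. -/
theorem exists_tendsto_of_deriv_pos_of_bounded {v : ℝ → ℝ} (hv : Differentiable ℝ v) {M T : ℝ}
    (hb : ∀ t, |v t| ≤ M) (hpos : ∀ t, T ≤ t → 0 < deriv v t) :
    ∃ ℓ, Tendsto v atTop (nhds ℓ) := by
  have hmono : MonotoneOn v (Set.Ici T) :=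
    monotoneOn_of_deriv_nonneg (convex_Ici T) hv.continuous.continuousOn
      hv.differentiableOn fun x hx => (hpos x (interior_subset hx)).le
  have hm : Monotone fun t => v (max t T) := fun x y hxy =>
    hmono (Set.mem_Ici.2 (le_max_right _ _)) (Set.mem_Ici.2 (le_max_right _ _))
      (max_le_max_right _ hxy)
  have hbdd : BddAbove (Set.range fun t => v (max t T)) :=
    ⟨M, by rintro _ ⟨t, rfl⟩; exact (le_abs_self _).trans (hb _)⟩
  refine ⟨_, (tendsto_atTop_ciSup hm hbdd).congr' ?_⟩
  filter_upwards [eventually_ge_atTop T] with t ht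
  rw [max_eq_left ht]

theorem cN_pos {n : ℕ} (hn : 7 ≤ n) : 0 < cN n := by
  have h : (7 : ℝ) ≤ n := by exact_mod_cast hn
  have h1 : (0 : ℝ) < (n : ℝ) - 6 := by linarith
  have h2 : (0 : ℝ) < (n : ℝ) ^ 2 - 4 := by nlinarith
  have h3 : (0 : ℝ) < (n : ℝ) ^ 2 - 16 := by nlinarith
  have e : cN n = (n : ℝ) * ((n : ℝ) - 6) * (((n : ℝ) ^ 2 - 4) * ((n : ℝ) ^ 2 - 16)) / 64 := by
    unfold cN
    ring
  rw [e]
  positivity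

theorem mem_equilibria {n : ℕ} (hn : 7 ≤ n) {ℓ : ℝ}
    (h : K0 n * ℓ = cN n * |ℓ| ^ (12 / ((n : ℝ) - 6)) * ℓ) :
    ℓ ∈ ({0, aStar n, -aStar n} : Set ℝ) := by
  have h1 : (0 : ℝ) < (n : ℝ) - 6 := by
    have : (7 : ℝ) ≤ n := by exact_mod_cast hn
    linarith
  rcases eq_or_ne ℓ 0 with h0 | h0
  · exact Or.inl h0
  have hK : K0 n / cN n = |ℓ| ^ (12 / ((n : ℝ) - 6)) := by
    rw [mul_right_cancel₀ h0 h, mul_div_cancel_left₀ _ (cN_pos hn).ne']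
  have ha : aStar n = |ℓ| := by
    rw [aStar, hK, ← Real.rpow_mul (abs_nonneg ℓ)]
    rw [show 12 / ((n : ℝ) - 6) * (((n : ℝ) - 6) / 12) = 1 by field_simp, Real.rpow_one]
  rw [ha]
  rcases abs_choice ℓ with e | e
  · exact Or.inr (Or.inl e.symm)
  · exact Or.inr (Or.inr (by rw [Set.mem_singleton_iff, e, neg_neg]))

theorem limits_of_eventually_monotone_bounded_solutions
    (n : ℕ) (hn : 7 ≤ n) (v : ℝ → ℝ) (hv : IsSolO6 n v)
    (hb : ∃ M : ℝ, ∀ t : ℝ, |v t| ≤ M)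
    (hmono : (∃ T : ℝ, ∀ t : ℝ, T ≤ t → 0 < deriv v t) ∨
             (∃ T : ℝ, ∀ t : ℝ, T ≤ t → deriv v t < 0)) :
    (∃ ℓ : ℝ, ℓ ∈ ({0, aStar n, -aStar n} : Set ℝ) ∧ Tendsto v atTop (nhds ℓ)) ∧
    (∀ j : ℕ, 1 ≤ j → j ≤ 5 → Tendsto (iteratedDeriv j v) atTop (nhds 0)) := by
  obtain ⟨hsm, hode⟩ := hv
  obtain ⟨M, hM⟩ := hb
  have hdiff : Differentiable ℝ v := hsm.differentiable (by norm_num)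
  obtain ⟨ℓ, hℓ⟩ : ∃ ℓ, Tendsto v atTop (nhds ℓ) := by
    rcases hmono with ⟨T, hT⟩ | ⟨T, hT⟩
    · exact exists_tendsto_of_deriv_pos_of_bounded hdiff hM hT
    · obtain ⟨ℓ, h⟩ := exists_tendsto_of_deriv_pos_of_bounded (v := -v) (M := M) (T := T) hdiff.neg
        (fun t => by simpa using hM t) (fun t ht => by
          rw [deriv.neg]
          exact neg_pos.2 (hT t ht))
      exact ⟨-ℓ, by simpa using h.neg⟩
  have hp : 0 ≤ 12 / ((n : ℝ) - 6) := by
    have : (7 : ℝ) ≤ n := by exact_mod_cast hn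
    exact div_nonneg (by norm_num) (by linarith)
  have hd : ∀ k < 6, ∀ t, HasDerivAt (iteratedDeriv k v) (iteratedDeriv (k + 1) v t) t := by
    intro k hk t
    rw [iteratedDeriv_succ]
    exact (hsm.differentiable_iteratedDeriv k (by exact_mod_cast hk) t).hasDerivAt
  have hc6 : Continuous (iteratedDeriv 6 v) := hsm.continuous_iteratedDeriv 6 le_rfl
  let f : ℕ → ℝ → ℝ := fun k =>
    if k = 0 then fun t => v t - ℓ else if k ≤ 6 then iteratedDeriv k v else 0
  have hzero : ∀ k ≤ 5, Tendsto (f k) atTop (nhds 0) := by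
    refine tendsto_zero_derivs_of_sixth_order_bound (a := |K4 n|) (b := |K2 n|)
      (B := |K0 n| * M + |cN n| * M ^ (12 / ((n : ℝ) - 6)) * M) (P := M + |ℓ|) ?_ ?_
      (abs_nonneg _) (abs_nonneg _) ?_ ?_ ?_
    · intro k hk t
      rcases Nat.eq_zero_or_pos k with rfl | hk0
      · simpa [f] using (hd 0 (by norm_num) t).sub_const ℓ
      · simpa [f, hk0.ne', hk.le, Nat.succ_le_of_lt hk] using hd k hk t
    · intro k
      by_cases h0 : k = 0
      · have h : Continuous fun t => v t - ℓ := hdiff.continuous.sub continuous_const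
        simpa [f, h0] using h
      by_cases h6 : k ≤ 6
      · simpa [f, h0, h6] using hsm.continuous_iteratedDeriv k (by exact_mod_cast h6)
      · simpa [f, h0, h6] using (continuous_zero : Continuous (0 : ℝ → ℝ))
    · intro t
      have e : iteratedDeriv 6 v t = K4 n * iteratedDeriv 4 v t - K2 n * iteratedDeriv 2 v t
          + K0 n * v t - cN n * |v t| ^ (12 / ((n : ℝ) - 6)) * v t := by
        linarith [hode t]
      have hM0 : 0 ≤ M := (abs_nonneg _).trans (hM t)
      have i1 : |K0 n * v t| ≤ |K0 n| * M := by
        rw [abs_mul]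
        gcongr
        exact hM t
      have i2 : |cN n * |v t| ^ (12 / ((n : ℝ) - 6)) * v t|
          ≤ |cN n| * M ^ (12 / ((n : ℝ) - 6)) * M := by
        rw [abs_mul, abs_mul, abs_of_nonneg (Real.rpow_nonneg (abs_nonneg (v t)) _)]
        gcongr
        · exact hM t
        · exact hM t
      have goal : |iteratedDeriv 6 v t| ≤ |K4 n| * |iteratedDeriv 4 v t|
          + |K2 n| * |iteratedDeriv 2 v t|
          + (|K0 n| * M + |cN n| * M ^ (12 / ((n : ℝ) - 6)) * M) := by
        rw [e, ← abs_mul, ← abs_mul]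
        have j1 := abs_sub (K4 n * iteratedDeriv 4 v t - K2 n * iteratedDeriv 2 v t
          + K0 n * v t) (cN n * |v t| ^ (12 / ((n : ℝ) - 6)) * v t)
        have j2 := abs_add_le (K4 n * iteratedDeriv 4 v t - K2 n * iteratedDeriv 2 v t)
          (K0 n * v t)
        have j3 := abs_sub (K4 n * iteratedDeriv 4 v t) (K2 n * iteratedDeriv 2 v t)
        linarith
      simpa [f] using goal
    · intro t
      have := abs_sub (v t) ℓ
      simpa [f] using this.trans (by linarith [hM t])
    · simpa [f] using hℓ.sub_const ℓ
  have hders : ∀ j : ℕ, 1 ≤ j → j ≤ 5 → Tendsto (iteratedDeriv j v) atTop (nhds 0) := by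
    intro j hj1 hj5
    simpa [f, (show j ≠ 0 by omega), (show j ≤ 6 by omega)] using hzero j hj5
  refine ⟨⟨ℓ, mem_equilibria hn ?_, hℓ⟩, hders⟩
  have hlim6 : Tendsto (iteratedDeriv 6 v) atTop
      (nhds (K4 n * 0 - K2 n * 0 + K0 n * ℓ - cN n * |ℓ| ^ (12 / ((n : ℝ) - 6)) * ℓ)) := by
    have h4 := (hders 4 (by norm_num) (by norm_num)).const_mul (K4 n)
    have h2 := (hders 2 (by norm_num) (by norm_num)).const_mul (K2 n)
    have hr := ((hℓ.abs.rpow_const (Or.inr hp)).const_mul (cN n)).mul hℓ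
    refine (((h4.sub h2).add (hℓ.const_mul (K0 n))).sub hr).congr fun t => ?_
    linarith [hode t]
  have h0 := eq_zero_of_tendsto_of_tendsto_deriv (hd 5 (by norm_num))
    (hders 5 (by norm_num) le_rfl) hlim6
  linarith
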